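/- Let u = √3/2, let f₁ = z, f₂ = x²+y², f₃ = 11x⁶+15x⁴y²+45x²y⁴+9y⁶ in ℝ[x,y,z], and let Γ = (2093688/17)f₁¹² − (9398511/34)f₁¹⁰f₂ + (2995218/17)f₁⁸f₂² − (64485153/1088)f₁⁶f₂³ + (18708003/4352)f₁⁴f₂⁴ + (1258659/4352)f₁²f₂⁵ − (493695/4352)f₂⁶ + (2121309/1088)f₁⁶f₃ − (402561/4352)f₁⁴f₂f₃ − (158697/4352)f₁²f₂²f₃ + (2619/128)f₂³f₃ − (3979/4352)f₃². Let B₂₁ be the arrangement of 21 lines obtained from the linear forms x∓uz, x∓4uz, y, y∓z and their images under rotations by 60° and 120° about (0:0:1), and let G be the dihedral group of order 12 generated by A = [[1/2, −u, 0],[u, 1/2, 0],[0, 0, 1]] and B = [[−1,0,0],[0,1,0],[0,0,1]]. Then Γ is a G-invariant homogeneous polynomial of degree 12 that vanishes to order at least 2 (i.e. Γ and all of its first-order partial derivatives vanish) at each of the 12 points of the G-orbit of the point (9 : 2u : 4u), and Γ vanishes at each of the 72 points lying on exactly two lines of B₂₁. -/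

import Mathlib

open MvPolynomial

noncomputable section

/-- The polynomial ring `ℝ[x,y,z]`, with `x = X 0`, `y = X 1`, `z = X 2`. -/
abbrev PolyR := MvPolynomial (Fin 3) ℝ

/-- `u = √3 / 2`. -/
def u : ℝ := Real.sqrt 3 / 2

/-- The rotation by 60° about `(0:0:1)`. -/
def rotA : Matrix (Fin 3) (Fin 3) ℝ := !![1/2, -u, 0; u, 1/2, 0; 0, 0, 1]

/-- The reflection `B`. -/
def matB : Matrix (Fin 3) (Fin 3) ℝ := !![-1, 0, 0; 0, 1, 0; 0, 0, 1]

/-- The rotation `A` as an element of `GL₃(ℝ)`. -/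
def glA : Matrix.GeneralLinearGroup (Fin 3) ℝ :=
  Matrix.GeneralLinearGroup.mkOfDetNeZero rotA (by
    have h3 : Real.sqrt 3 * Real.sqrt 3 = 3 := Real.mul_self_sqrt (by norm_num)
    simp [rotA, u, Matrix.det_fin_three]
    nlinarith [Real.sqrt_nonneg 3])

/-- The reflection `B` as an element of `GL₃(ℝ)`. -/
def glB : Matrix.GeneralLinearGroup (Fin 3) ℝ :=
  Matrix.GeneralLinearGroup.mkOfDetNeZero matB (by
    simp [matB, Matrix.det_fin_three])

/-- The subgroup `G ⊆ GL₃(ℝ)` generated by `A` and `B`; it is dihedral of order 12. -/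
def Ggrp : Subgroup (Matrix.GeneralLinearGroup (Fin 3) ℝ) := Subgroup.closure {glA, glB}

/-- Linear substitution of variables by a matrix `M`:  `(substMat M f)(v) = f(M v)`. -/
def substMat (M : Matrix (Fin 3) (Fin 3) ℝ) : PolyR →ₐ[ℝ] PolyR :=
  MvPolynomial.aeval fun i => ∑ j, MvPolynomial.C (M i j) * MvPolynomial.X j

/-- The seven initial linear forms of the arrangement `B₂₁`:
`x ∓ uz`, `x ∓ 4uz`, `y`, `y ∓ z`. -/
def baseFormsB : Fin 7 → PolyR :=
  ![X 0 - C u * X 2, X 0 + C u * X 2, X 0 - C (4*u) * X 2, X 0 + C (4*u) * X 2,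
    X 1, X 1 - X 2, X 1 + X 2]

/-- The 21 linear forms defining the arrangement `B₂₁`: the seven initial forms and their
images under the rotations by 60° and 120° about `(0:0:1)`. -/
def linesB21 : Fin 21 → PolyR := fun i =>
  if h : (i : ℕ) < 7 then baseFormsB ⟨i, h⟩
  else if h2 : (i : ℕ) < 14 then substMat rotA⁻¹ (baseFormsB ⟨(i : ℕ) - 7, by omega⟩)
  else substMat (rotA ^ 2)⁻¹ (baseFormsB ⟨(i : ℕ) - 14, by omega⟩)

/-- The real projective plane `ℙ²(ℝ)`. -/
abbrev P2R := Projectivization ℝ (Fin 3 → ℝ)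

open Classical in
/-- The number of lines of `B₂₁` passing through a point `P ∈ ℙ²(ℝ)`. -/
def multB21 (P : P2R) : ℕ :=
  (Finset.univ.filter fun i => MvPolynomial.eval (Projectivization.rep P) (linesB21 i) = 0).card

/-- The `G`-orbit in `ℙ²(ℝ)` of the point with homogeneous coordinates `v`: the set of
points `Q` whose representative is proportional to `M·v` for some `M ∈ G`. -/
def orbitOf (v : Fin 3 → ℝ) : Set P2R :=
  {Q | ∃ M ∈ Ggrp, ∃ c : ℝ, c ≠ 0 ∧
    (M : Matrix (Fin 3) (Fin 3) ℝ).mulVec v = c • Projectivization.rep Q}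

/-- The invariant `f₁ = z`. -/
def f1 : PolyR := X 2

/-- The invariant `f₂ = x² + y²`. -/
def f2 : PolyR := X 0 ^ 2 + X 1 ^ 2

/-- The invariant `f₃ = 11x⁶ + 15x⁴y² + 45x²y⁴ + 9y⁶`. -/
def f3 : PolyR :=
  C 11 * X 0 ^ 6 + C 15 * X 0 ^ 4 * X 1 ^ 2 + C 45 * X 0 ^ 2 * X 1 ^ 4 + C 9 * X 1 ^ 6

/-- The degree-12 curve `Γ`, expressed in terms of the invariants `f₁`, `f₂`, `f₃`. -/
def Γpoly : PolyR :=
  C (2093688/17) * f1 ^ 12 - C (9398511/34) * f1 ^ 10 * f2 + C (2995218/17) * f1 ^ 8 * f2 ^ 2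
    - C (64485153/1088) * f1 ^ 6 * f2 ^ 3 + C (18708003/4352) * f1 ^ 4 * f2 ^ 4
    + C (1258659/4352) * f1 ^ 2 * f2 ^ 5 - C (493695/4352) * f2 ^ 6
    + C (2121309/1088) * f1 ^ 6 * f3 - C (402561/4352) * f1 ^ 4 * f2 * f3
    - C (158697/4352) * f1 ^ 2 * f2 ^ 2 * f3 + C (2619/128) * f2 ^ 3 * f3
    - C (3979/4352) * f3 ^ 2

end

lemma usq : u ^ 2 = 3 / 4 := by
  have h3 : Real.sqrt 3 ^ 2 = 3 := Real.sq_sqrt (by norm_num)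
  unfold u; rw [div_pow, h3]; norm_num

lemma upos : 0 < u := by unfold u; positivity

lemma rotA_inv : rotA⁻¹ = !![1/2, u, 0; -u, 1/2, 0; 0, 0, 1] := by
  apply Matrix.inv_eq_right_inv
  have h := usq
  ext i j
  fin_cases i <;> fin_cases j <;> simp [rotA, Matrix.mul_apply, Fin.sum_univ_three] <;>
    linarith

lemma rotA2_inv : (rotA ^ 2)⁻¹ = !![-1/2, u, 0; -u, -1/2, 0; 0, 0, 1] := by
  have h := usq
  rw [← Matrix.inv_pow', rotA_inv, pow_two]
  ext i j
  fin_cases i <;> fin_cases j <;> simp [Matrix.mul_apply, Fin.sum_univ_three] <;>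
    linarith

lemma eval_substMat (M : Matrix (Fin 3) (Fin 3) ℝ) (v : Fin 3 → ℝ) (f : PolyR) :
    eval v (substMat M f) = eval (M.mulVec v) f := by
  unfold substMat
  induction f using MvPolynomial.induction_on with
  | C a => simp
  | add p q hp hq => rw [map_add, map_add, map_add, hp, hq]
  | mul_X p i hp =>
    rw [map_mul, map_mul, map_mul, hp]
    simp [Matrix.mulVec, dotProduct]

/-- The integer coefficients of the lines, in the coordinates `(x/u, y, z)`. -/
def lz : Fin 21 → ℤ × ℤ × ℤ :=
  ![(1,0,-1),(1,0,1),(1,0,-4),(1,0,4),(0,1,0),(0,1,-1),(0,1,1),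
    (1,2,-2),(1,2,2),(1,2,-8),(1,2,8),(-3,2,0),(-3,2,-4),(-3,2,4),
    (-1,2,-2),(-1,2,2),(-1,2,-8),(-1,2,8),(-3,-2,0),(-3,-2,-4),(-3,-2,4)]

noncomputable def kz : Fin 21 → ℝ :=
  ![u,u,u,u,1,1,1,u/2,u/2,u/2,u/2,1/4,1/4,1/4,u/2,u/2,u/2,u/2,1/4,1/4,1/4]

lemma kz_ne (i : Fin 21) : kz i ≠ 0 := by
  have := upos.ne'
  fin_cases i <;> simp [kz, this]

lemma eval_line (v : Fin 3 → ℝ) (X : ℝ) (hX : v 0 = u * X) (i : Fin 21) :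
    eval v (linesB21 i) = kz i * ((lz i).1 * X + (lz i).2.1 * v 1 + (lz i).2.2 * v 2) := by
  have h := usq
  have h' : u * (u * X) = 3 / 4 * X := by rw [← h]; ring
  fin_cases i <;>
    simp [linesB21, kz, lz, eval_substMat, baseFormsB, rotA_inv, rotA2_inv, Matrix.mulVec,
      dotProduct, Fin.sum_univ_three, hX, h'] <;> ring

def Hz (X y z : ℤ) : ℤ :=
  let F2 := 3 * X ^ 2 + 4 * y ^ 2
  let F3 := 297 * X ^ 6 + 540 * X ^ 4 * y ^ 2 + 2160 * X ^ 2 * y ^ 4 + 576 * y ^ 6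
  535984128*4096 * z ^ 12 - 9398511*128*1024 * z ^ 10 * F2 + 2995218*256*256 * z ^ 8 * F2 ^ 2
   - 64485153*4*64 * z ^ 6 * F2 ^ 3 + 18708003*16 * z ^ 4 * F2 ^ 4 + 1258659*4 * z ^ 2 * F2 ^ 5
   - 493695 * F2 ^ 6 + 2121309*4*64 * z ^ 6 * F3 - 402561*16 * z ^ 4 * F2 * F3
   - 158697*4 * z ^ 2 * F2 ^ 2 * F3 + 2619*34 * F2 ^ 3 * F3 - 3979 * F3 ^ 2

def crz (a b : ℤ × ℤ × ℤ) : ℤ × ℤ × ℤ :=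
  (a.2.1 * b.2.2 - a.2.2 * b.2.1, a.2.2 * b.1 - a.1 * b.2.2, a.1 * b.2.1 - a.2.1 * b.1)

def dtz (a b : ℤ × ℤ × ℤ) : ℤ := a.1 * b.1 + a.2.1 * b.2.1 + a.2.2 * b.2.2

set_option maxRecDepth 100000 in
lemma crz_ne : ∀ i j : Fin 21, i ≠ j → crz (lz i) (lz j) ≠ (0, 0, 0) := by decide +kernel

set_option maxRecDepth 100000 in
lemma double : ∀ i j : Fin 21, i ≠ j →
    (∃ k, k ≠ i ∧ k ≠ j ∧ dtz (lz k) (crz (lz i) (lz j)) = 0) ∨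
    Hz (crz (lz i) (lz j)).1 (crz (lz i) (lz j)).2.1 (crz (lz i) (lz j)).2.2 = 0 := by
  decide +kernel

lemma eval_Γ_explicit (v : Fin 3 → ℝ) : eval v Γpoly =
    (2093688/17) * v 2 ^ 12 - (9398511/34) * v 2 ^ 10 * (v 0 ^ 2 + v 1 ^ 2)
    + (2995218/17) * v 2 ^ 8 * (v 0 ^ 2 + v 1 ^ 2) ^ 2
    - (64485153/1088) * v 2 ^ 6 * (v 0 ^ 2 + v 1 ^ 2) ^ 3
    + (18708003/4352) * v 2 ^ 4 * (v 0 ^ 2 + v 1 ^ 2) ^ 4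
    + (1258659/4352) * v 2 ^ 2 * (v 0 ^ 2 + v 1 ^ 2) ^ 5
    - (493695/4352) * (v 0 ^ 2 + v 1 ^ 2) ^ 6
    + (2121309/1088) * v 2 ^ 6
      * (11 * v 0 ^ 6 + 15 * v 0 ^ 4 * v 1 ^ 2 + 45 * v 0 ^ 2 * v 1 ^ 4 + 9 * v 1 ^ 6)
    - (402561/4352) * v 2 ^ 4 * (v 0 ^ 2 + v 1 ^ 2)
      * (11 * v 0 ^ 6 + 15 * v 0 ^ 4 * v 1 ^ 2 + 45 * v 0 ^ 2 * v 1 ^ 4 + 9 * v 1 ^ 6)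
    - (158697/4352) * v 2 ^ 2 * (v 0 ^ 2 + v 1 ^ 2) ^ 2
      * (11 * v 0 ^ 6 + 15 * v 0 ^ 4 * v 1 ^ 2 + 45 * v 0 ^ 2 * v 1 ^ 4 + 9 * v 1 ^ 6)
    + (2619/128) * (v 0 ^ 2 + v 1 ^ 2) ^ 3
      * (11 * v 0 ^ 6 + 15 * v 0 ^ 4 * v 1 ^ 2 + 45 * v 0 ^ 2 * v 1 ^ 4 + 9 * v 1 ^ 6)
    - (3979/4352)
      * (11 * v 0 ^ 6 + 15 * v 0 ^ 4 * v 1 ^ 2 + 45 * v 0 ^ 2 * v 1 ^ 4 + 9 * v 1 ^ 6) ^ 2 := by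
  simp only [Γpoly, f1, f2, f3, map_add, map_sub, map_mul, map_pow, eval_C, eval_X]

lemma eval_Γ (v : Fin 3 → ℝ) (t : ℝ) (a b c : ℤ) (h0 : v 0 = u * (t * a)) (h1 : v 1 = t * b)
    (h2 : v 2 = t * c) : eval v Γpoly = t ^ 12 / (4352 * 4096) * (Hz a b c : ℤ) := by
  have e2 : (v 0) ^ 2 = 3 / 4 * t ^ 2 * a ^ 2 := by
    rw [h0, mul_pow, usq]; ring
  have e4 : (v 0) ^ 4 = (3 / 4 * t ^ 2 * a ^ 2) ^ 2 := by rw [← e2]; ring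
  have e6 : (v 0) ^ 6 = (3 / 4 * t ^ 2 * a ^ 2) ^ 3 := by rw [← e2]; ring
  rw [eval_Γ_explicit, e2, e4, e6, h1, h2]
  unfold Hz
  push_cast
  ring

lemma part5 (Q : P2R) (hQ : multB21 Q = 2) : eval (Projectivization.rep Q) Γpoly = 0 := by
  classical
  set v := Projectivization.rep Q with hv
  obtain ⟨X, hX⟩ : ∃ X, v 0 = u * X := ⟨v 0 / u, by field_simp [upos.ne']⟩
  unfold multB21 at hQ
  obtain ⟨i, j, hij, hs⟩ := Finset.card_eq_two.mp hQ
  have hmem : ∀ k, ((lz k).1 * X + (lz k).2.1 * v 1 + (lz k).2.2 * v 2 = 0) ↔ (k = i ∨ k = j) := by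
    intro k
    have := congrArg (fun s => k ∈ s) hs
    simp only [Finset.mem_filter, Finset.mem_univ, true_and, Finset.mem_insert,
      Finset.mem_singleton, eq_iff_iff] at this
    rw [← this, ← hv, eval_line v X hX k]
    simp [kz_ne k]
  have hi := (hmem i).2 (Or.inl rfl)
  have hj := (hmem j).2 (Or.inr rfl)
  have hc := crz_ne i j hij
  have hd := double i j hij
  obtain ⟨t, ht0, ht1, ht2⟩ : ∃ t : ℝ, X = t * (crz (lz i) (lz j)).1 ∧
      v 1 = t * (crz (lz i) (lz j)).2.1 ∧ v 2 = t * (crz (lz i) (lz j)).2.2 := by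
    clear hd hmem hs
    generalize lz i = a at *
    generalize lz j = b at *
    obtain ⟨a1, a2, a3⟩ := a
    obtain ⟨b1, b2, b3⟩ := b
    simp only [crz, ne_eq, Prod.mk.injEq, not_and_or] at *
    have c1 : (a2 * b3 - a3 * b2 : ℝ) * v 1 = (a3 * b1 - a1 * b3) * X := by
      linear_combination (b3:ℝ) * hi - (a3:ℝ) * hj
    have c2 : (a2 * b3 - a3 * b2 : ℝ) * v 2 = (a1 * b2 - a2 * b1) * X := by
      linear_combination -(b2:ℝ) * hi + (a2:ℝ) * hj
    have c3 : (a3 * b1 - a1 * b3 : ℝ) * v 2 = (a1 * b2 - a2 * b1) * v 1 := by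
      linear_combination (b1:ℝ) * hi - (a1:ℝ) * hj
    push_cast
    rcases hc with h | h | h
    · have h : (a2 * b3 - a3 * b2 : ℝ) ≠ 0 := by exact_mod_cast h
      refine ⟨X / (a2 * b3 - a3 * b2), ?_, ?_, ?_⟩ <;> field_simp <;> linarith
    · have h : (a3 * b1 - a1 * b3 : ℝ) ≠ 0 := by exact_mod_cast h
      refine ⟨v 1 / (a3 * b1 - a1 * b3), ?_, ?_, ?_⟩ <;> field_simp <;> linarith
    · have h : (a1 * b2 - a2 * b1 : ℝ) ≠ 0 := by exact_mod_cast h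
      refine ⟨v 2 / (a1 * b2 - a2 * b1), ?_, ?_, ?_⟩ <;> field_simp <;> linarith
  rcases hd with ⟨k, hki, hkj, hk⟩ | hd
  · exfalso
    have : k = i ∨ k = j := by
      rw [← hmem k, ht0, ht1, ht2]
      have hk' : ((dtz (lz k) (crz (lz i) (lz j)) : ℤ) : ℝ) = 0 := by exact_mod_cast hk
      unfold dtz at hk'
      push_cast at hk'
      linear_combination t * hk'
    tauto
  · rw [eval_Γ v t _ _ _ (by rw [hX, ht0]) ht1 ht2, hd]; simp

lemma part1 : Γpoly.IsHomogeneous 12 := by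
  have h1 : f1.IsHomogeneous 1 := isHomogeneous_X _ _
  have h2 : f2.IsHomogeneous 2 := by
    unfold f2
    exact (isHomogeneous_X_pow _ _).add (isHomogeneous_X_pow _ _)
  have hC : ∀ c : ℝ, (C c : PolyR).IsHomogeneous 0 := fun c => isHomogeneous_C _ _
  have hX : ∀ i n, (X i ^ n : PolyR).IsHomogeneous n := fun i n => isHomogeneous_X_pow _ _
  have h3 : f3.IsHomogeneous 6 := by
    unfold f3
    refine ((IsHomogeneous.add ?_ ?_).add ?_).add ?_
    · simpa using (hC 11).mul (hX 0 6)
    · simpa using ((hC 15).mul (hX 0 4)).mul (hX 1 2)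
    · simpa using ((hC 45).mul (hX 0 2)).mul (hX 1 4)
    · simpa using (hC 9).mul (hX 1 6)
  have g1 : ∀ n, (f1 ^ n).IsHomogeneous n := fun n => by simpa using h1.pow n
  have g2 : ∀ n, (f2 ^ n).IsHomogeneous (2 * n) := fun n => h2.pow n
  unfold Γpoly
  refine ((((((((((IsHomogeneous.sub ?_ ?_).add ?_).sub ?_).add ?_).add ?_).sub ?_).add ?_).sub
    ?_).sub ?_).add ?_).sub ?_
  · simpa using (hC _).mul (g1 12)
  · simpa using ((hC _).mul (g1 10)).mul h2
  · simpa using ((hC _).mul (g1 8)).mul (g2 2)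
  · simpa using ((hC _).mul (g1 6)).mul (g2 3)
  · simpa using ((hC _).mul (g1 4)).mul (g2 4)
  · simpa using ((hC _).mul (g1 2)).mul (g2 5)
  · simpa using (hC _).mul (g2 6)
  · simpa using ((hC _).mul (g1 6)).mul h3
  · simpa using (((hC _).mul (g1 4)).mul h2).mul h3
  · simpa using (((hC _).mul (g1 2)).mul (g2 2)).mul h3
  · simpa using ((hC _).mul (g2 3)).mul h3
  · simpa using (hC _).mul (h3.pow 2)

lemma glA_coe : (glA : Matrix (Fin 3) (Fin 3) ℝ) = rotA := rfl
lemma glB_coe : (glB : Matrix (Fin 3) (Fin 3) ℝ) = matB := rfl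

lemma mulVec_A (v : Fin 3 → ℝ) :
    rotA.mulVec v = ![v 0 / 2 - u * v 1, u * v 0 + v 1 / 2, v 2] := by
  ext i
  fin_cases i <;> simp [rotA, Matrix.mulVec, dotProduct, Fin.sum_univ_three] <;> ring

lemma mulVec_B (v : Fin 3 → ℝ) : matB.mulVec v = ![- v 0, v 1, v 2] := by
  ext i
  fin_cases i <;> simp [matB, Matrix.mulVec, dotProduct, Fin.sum_univ_three]

lemma inv_A (v : Fin 3 → ℝ) : eval (rotA.mulVec v) Γpoly = eval v Γpoly := by
  rw [mulVec_A]
  have h2 : (v 0 / 2 - u * v 1) ^ 2 + (u * v 0 + v 1 / 2) ^ 2 = v 0 ^ 2 + v 1 ^ 2 := by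
    linear_combination (v 0 ^ 2 + v 1 ^ 2) * usq
  have h3 : 11 * (v 0 / 2 - u * v 1) ^ 6
      + 15 * (v 0 / 2 - u * v 1) ^ 4 * (u * v 0 + v 1 / 2) ^ 2
      + 45 * (v 0 / 2 - u * v 1) ^ 2 * (u * v 0 + v 1 / 2) ^ 4 + 9 * (u * v 0 + v 1 / 2) ^ 6
      = 11 * v 0 ^ 6 + 15 * v 0 ^ 4 * v 1 ^ 2 + 45 * v 0 ^ 2 * v 1 ^ 4 + 9 * v 1 ^ 6 := by
    have u2 := usq
    have u3 : u ^ 3 = 3 / 4 * u := by rw [← u2]; ring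
    have u4 : u ^ 4 = 9 / 16 := by rw [show u ^ 4 = (u ^ 2) ^ 2 by ring, u2]; norm_num
    have u5 : u ^ 5 = 9 / 16 * u := by rw [← u4]; ring
    have u6 : u ^ 6 = 27 / 64 := by rw [show u ^ 6 = (u ^ 2) ^ 3 by ring, u2]; norm_num
    ring_nf
    simp only [u2, u3, u4, u5, u6]
    ring
  simp only [eval_Γ_explicit, Matrix.cons_val_zero, Matrix.cons_val_one, Matrix.cons_val]
  rw [h2, h3]

lemma inv_B (v : Fin 3 → ℝ) : eval (matB.mulVec v) Γpoly = eval v Γpoly := by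
  rw [mulVec_B]
  simp only [eval_Γ_explicit, Matrix.cons_val_zero, Matrix.cons_val_one, Matrix.cons_val]
  ring

lemma part2 (M : Matrix.GeneralLinearGroup (Fin 3) ℝ) (hM : M ∈ Ggrp) :
    substMat (M : Matrix (Fin 3) (Fin 3) ℝ) Γpoly = Γpoly := by
  apply MvPolynomial.funext
  intro v
  rw [eval_substMat]
  revert v
  unfold Ggrp at hM
  induction hM using Subgroup.closure_induction with
  | mem x hx =>
    rcases hx with rfl | rfl
    · exact inv_A
    · exact inv_B
  | one => intro v; simp
  | mul x y _ _ hx hy =>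
    intro v
    rw [Units.val_mul, ← Matrix.mulVec_mulVec, hx, hy]
  | inv x _ hx =>
    intro v
    rw [← hx, Matrix.mulVec_mulVec, ← Units.val_mul]
    simp

/-- the twelve points of the orbit are `(a : b u : 4 u)` with `(a, b)` in this set. -/
def TT : Finset (ℤ × ℤ) :=
  {(9,2),(9,-2),(-9,2),(-9,-2),(3,10),(3,-10),(-3,10),(-3,-10),(6,8),(6,-8),(-6,8),(-6,-8)}

noncomputable def PP (p : ℤ × ℤ) : Fin 3 → ℝ := ![p.1, p.2 * u, 4 * u]

lemma PP_A (p q : ℤ × ℤ) (h1 : 4 * q.1 = 2 * p.1 - 3 * p.2) (h2 : 2 * q.2 = 2 * p.1 + p.2) :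
    rotA.mulVec (PP p) = PP q := by
  have h1 : (4 * q.1 : ℝ) = 2 * p.1 - 3 * p.2 := by exact_mod_cast h1
  have h2 : (2 * q.2 : ℝ) = 2 * p.1 + p.2 := by exact_mod_cast h2
  rw [mulVec_A]
  ext i
  fin_cases i
  · simp [PP]; linear_combination -h1 / 4 - p.2 * usq
  · simp [PP]; linear_combination -h2 / 2 * u
  · simp [PP]

lemma PP_B (p : ℤ × ℤ) : matB.mulVec (PP p) = PP (-p.1, p.2) := by
  rw [mulVec_B]; simp [PP]

lemma TT_A : ∀ p ∈ TT, ∃ q ∈ TT, 4 * q.1 = 2 * p.1 - 3 * p.2 ∧ 2 * q.2 = 2 * p.1 + p.2 := by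
  decide
lemma TT_A' : ∀ q ∈ TT, ∃ p ∈ TT, 4 * q.1 = 2 * p.1 - 3 * p.2 ∧ 2 * q.2 = 2 * p.1 + p.2 := by
  decide
lemma TT_B : ∀ p ∈ TT, (-p.1, p.2) ∈ TT := by decide

lemma G_TT (M : Matrix.GeneralLinearGroup (Fin 3) ℝ) (hM : M ∈ Ggrp) :
    (∀ p ∈ TT, ∃ q ∈ TT, (M : Matrix (Fin 3) (Fin 3) ℝ).mulVec (PP p) = PP q) ∧
    (∀ q ∈ TT, ∃ p ∈ TT, (M : Matrix (Fin 3) (Fin 3) ℝ).mulVec (PP p) = PP q) := by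
  unfold Ggrp at hM
  induction hM using Subgroup.closure_induction with
  | mem x hx =>
    rcases hx with rfl | rfl
    · constructor
      · intro p hp
        obtain ⟨q, hq, h1, h2⟩ := TT_A p hp
        exact ⟨q, hq, PP_A p q h1 h2⟩
      · intro p hp
        obtain ⟨q, hq, h1, h2⟩ := TT_A' p hp
        exact ⟨q, hq, PP_A q p h1 h2⟩
    · constructor
      · intro p hp
        exact ⟨_, TT_B p hp, PP_B p⟩
      · intro p hp
        exact ⟨_, TT_B p hp, by rw [glB_coe, PP_B]; simp⟩
  | one => exact ⟨fun p hp => ⟨p, hp, by simp⟩, fun p hp => ⟨p, hp, by simp⟩⟩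
  | mul x y _ _ hx hy =>
    constructor
    · intro p hp
      obtain ⟨q, hq, e⟩ := hy.1 p hp
      obtain ⟨r, hr, e'⟩ := hx.1 q hq
      exact ⟨r, hr, by rw [Units.val_mul, ← Matrix.mulVec_mulVec, e, e']⟩
    · intro p hp
      obtain ⟨q, hq, e⟩ := hx.2 p hp
      obtain ⟨r, hr, e'⟩ := hy.2 q hq
      exact ⟨r, hr, by rw [Units.val_mul, ← Matrix.mulVec_mulVec, e', e]⟩
  | inv x _ hx =>
    constructor
    · intro p hp
      obtain ⟨q, hq, e⟩ := hx.2 p hp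
      exact ⟨q, hq, by rw [← e, Matrix.mulVec_mulVec, ← Units.val_mul]; simp⟩
    · intro p hp
      obtain ⟨q, hq, e⟩ := hx.1 p hp
      exact ⟨q, hq, by rw [← e, Matrix.mulVec_mulVec, ← Units.val_mul]; simp⟩

lemma PP_base : (![9, 2*u, 4*u] : Fin 3 → ℝ) = PP (9, 2) := by simp [PP]

lemma glA_mem : glA ∈ Ggrp := Subgroup.subset_closure (by simp)
lemma glB_mem : glB ∈ Ggrp := Subgroup.subset_closure (by simp)

lemma reach : ∀ p ∈ TT, ∃ M ∈ Ggrp, (M : Matrix (Fin 3) (Fin 3) ℝ).mulVec (PP (9, 2)) = PP p := by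
  have sA : ∀ p q : ℤ × ℤ, 4 * q.1 = 2 * p.1 - 3 * p.2 → 2 * q.2 = 2 * p.1 + p.2 →
      (∃ M ∈ Ggrp, (M : Matrix (Fin 3) (Fin 3) ℝ).mulVec (PP (9, 2)) = PP p) →
      (∃ M ∈ Ggrp, (M : Matrix (Fin 3) (Fin 3) ℝ).mulVec (PP (9, 2)) = PP q) := by
    rintro p q h1 h2 ⟨M, hM, e⟩
    exact ⟨glA * M, mul_mem glA_mem hM, by
      rw [Units.val_mul, ← Matrix.mulVec_mulVec, e, glA_coe, PP_A p q h1 h2]⟩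
  have sB : ∀ a b : ℤ,
      (∃ M ∈ Ggrp, (M : Matrix (Fin 3) (Fin 3) ℝ).mulVec (PP (9, 2)) = PP (a, b)) →
      (∃ M ∈ Ggrp, (M : Matrix (Fin 3) (Fin 3) ℝ).mulVec (PP (9, 2)) = PP (-a, b)) := by
    rintro a b ⟨M, hM, e⟩
    exact ⟨glB * M, mul_mem glB_mem hM, by
      rw [Units.val_mul, ← Matrix.mulVec_mulVec, e, glB_coe, PP_B]⟩
  have r0 : ∃ M ∈ Ggrp, (M : Matrix (Fin 3) (Fin 3) ℝ).mulVec (PP (9, 2)) = PP (9, 2) :=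
    ⟨1, one_mem _, by simp⟩
  have r1 := sA _ (3, 10) (by norm_num) (by norm_num) r0
  have r2 := sA _ (-6, 8) (by norm_num) (by norm_num) r1
  have r3 := sA _ (-9, -2) (by norm_num) (by norm_num) r2
  have r4 := sA _ (-3, -10) (by norm_num) (by norm_num) r3
  have r5 := sA _ (6, -8) (by norm_num) (by norm_num) r4
  have s0 := sB _ _ r0
  have s1 := sB _ _ r1
  have s2 := sB _ _ r2
  have s3 := sB _ _ r3
  have s4 := sB _ _ r4
  have s5 := sB _ _ r5
  simp only [neg_neg] at s2 s3 s4
  intro p hp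
  simp only [TT, Finset.mem_insert, Finset.mem_singleton] at hp
  rcases hp with rfl | rfl | rfl | rfl | rfl | rfl | rfl | rfl | rfl | rfl | rfl | rfl <;>
    assumption

lemma PP_ne (p : ℤ × ℤ) : PP p ≠ 0 := by
  intro h
  have := congrFun h 2
  simp [PP, upos.ne'] at this

lemma orbit_eq : orbitOf ![9, 2*u, 4*u] =
    (fun p => (Projectivization.mk ℝ (PP p) (PP_ne p) : P2R)) '' (TT : Set (ℤ × ℤ)) := by
  ext Q
  rw [PP_base]
  constructor
  · rintro ⟨M, hM, c, hc, e⟩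
    obtain ⟨q, hq, e'⟩ := (G_TT M hM).1 (9, 2) (by decide)
    refine ⟨q, hq, ?_⟩
    rw [e'] at e
    have := Projectivization.mk_rep Q
    simp only
    rw [← this, Projectivization.mk_eq_mk_iff']
    exact ⟨c, e.symm⟩
  · rintro ⟨q, hq, rfl⟩
    obtain ⟨M, hM, e⟩ := reach q hq
    obtain ⟨a, ha⟩ := Projectivization.exists_smul_eq_mk_rep ℝ (PP q) (PP_ne q)
    refine ⟨M, hM, ((a⁻¹ : ℝˣ) : ℝ), Units.ne_zero _, ?_⟩
    rw [e]
    simp only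
    rw [← ha]
    simp [Units.smul_def]

lemma part3 : (orbitOf ![9, 2*u, 4*u]).ncard = 12 := by
  rw [orbit_eq, Set.ncard_image_of_injective, Set.ncard_coe_finset]
  · decide
  · intro p q h
    simp only [Projectivization.mk_eq_mk_iff'] at h
    obtain ⟨c, h⟩ := h
    have h0 := congrFun h 0
    have h1 := congrFun h 1
    have h2 := congrFun h 2
    have hu := upos.ne'
    have hc : c = 1 := by
      simp [PP] at h2
      simpa [hu] using h2
    subst hc
    simp [PP, hu] at h0 h1
    ext
    · exact h0.symm
    · exact h1.symm

lemma sing (v : Fin 3 → ℝ) (s a b : ℝ) (h0 : v 0 ^ 2 = a * s) (h1 : v 1 ^ 2 = b * s)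
    (h2 : v 2 ^ 2 = 4 * s) (h : (a = 27 ∧ b = 1) ∨ (a = 3 ∧ b = 25) ∨ (a = 12 ∧ b = 16)) :
    eval v Γpoly = 0 ∧ ∀ i : Fin 3, eval v (pderiv i Γpoly) = 0 := by
  have ex : ∀ w t : ℝ, w ^ 2 = t → w ^ 3 = w * t ∧ w ^ 4 = t ^ 2 ∧ w ^ 5 = w * t ^ 2 ∧
      w ^ 6 = t ^ 3 ∧ w ^ 7 = w * t ^ 3 ∧ w ^ 8 = t ^ 4 ∧ w ^ 9 = w * t ^ 4 ∧ w ^ 10 = t ^ 5 ∧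
      w ^ 11 = w * t ^ 5 ∧ w ^ 12 = t ^ 6 := by
    rintro w t rfl
    refine ⟨?_, ?_, ?_, ?_, ?_, ?_, ?_, ?_, ?_, ?_⟩ <;> ring
  have E0 := ex _ _ h0
  have E1 := ex _ _ h1
  have E2 := ex _ _ h2
  have q2 : eval v f2 = (a + b) * s := by simp [f2, h0, h1]; ring
  have q3 : eval v f3 = (11 * a ^ 3 + 15 * a ^ 2 * b + 45 * a * b ^ 2 + 9 * b ^ 3) * s ^ 3 := by
    simp [f3, h0, h1, E0, E1]; ring
  have q1 : eval v f1 = v 2 := by simp [f1]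
  have d1 : ∀ i, eval v (pderiv i f1) = if i = 2 then 1 else 0 := by
    intro i; fin_cases i <;> simp [f1, pderiv_X]
  have d2 : ∀ i, eval v (pderiv i f2) = ![2 * v 0, 2 * v 1, 0] i := by
    intro i; fin_cases i <;> simp [f2, pderiv_X, Derivation.leibniz_pow]
  have d3 : ∀ i, eval v (pderiv i f3) =
      ![v 0 * (66 * a ^ 2 + 60 * a * b + 90 * b ^ 2) * s ^ 2,
        v 1 * (30 * a ^ 2 + 180 * a * b + 54 * b ^ 2) * s ^ 2, 0] i := by
    intro i
    fin_cases i <;> simp [f3, pderiv_X, Derivation.leibniz_pow, Derivation.leibniz, E0, E1, h0, h1]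
      <;> ring
  constructor
  · simp only [Γpoly, map_add, map_sub, map_mul, map_pow, eval_C, q1, q2, q3, h2, E2]
    rcases h with ⟨rfl, rfl⟩ | ⟨rfl, rfl⟩ | ⟨rfl, rfl⟩ <;> ring
  · intro i
    simp only [Γpoly, map_add, map_sub, map_mul, map_pow, eval_C, q1, q2, q3, h2, E2,
      Derivation.leibniz, Derivation.leibniz_pow, pderiv_C, d1, d2, d3, smul_eq_mul, nsmul_eq_mul,
      map_zero, map_natCast, mul_zero, add_zero, Nat.reduceSub, pow_one]
    rcases h with ⟨rfl, rfl⟩ | ⟨rfl, rfl⟩ | ⟨rfl, rfl⟩ <;> fin_cases i <;> simp <;> ring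

lemma part4 (Q : P2R) (hQ : Q ∈ orbitOf ![9, 2*u, 4*u]) :
    eval (Projectivization.rep Q) Γpoly = 0 ∧
      ∀ i : Fin 3, eval (Projectivization.rep Q) (pderiv i Γpoly) = 0 := by
  rw [orbit_eq] at hQ
  obtain ⟨p, hp, rfl⟩ := hQ
  simp only
  obtain ⟨c, hc⟩ := Projectivization.exists_smul_eq_mk_rep ℝ (PP p) (PP_ne p)
  rw [← hc]
  have hT : ∀ p ∈ TT, (p.1 ^ 2 = 81 ∧ p.2 ^ 2 = 4) ∨ (p.1 ^ 2 = 9 ∧ p.2 ^ 2 = 100) ∨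
    (p.1 ^ 2 = 36 ∧ p.2 ^ 2 = 64) := by decide
  have hu := usq
  apply sing _ (3 * (c : ℝ) ^ 2) ((p.1 : ℝ) ^ 2 / 3) ((p.2 : ℝ) ^ 2 / 4)
  · simp [PP, Units.smul_def]; ring
  · simp [PP, Units.smul_def, mul_pow, hu]; ring
  · simp [PP, Units.smul_def, mul_pow, hu]; ring
  · rcases hT p hp with ⟨h, h'⟩ | ⟨h, h'⟩ | ⟨h, h'⟩
    all_goals
      have h := congrArg (Int.cast : ℤ → ℝ) h
      have h' := congrArg (Int.cast : ℤ → ℝ) h'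
      push_cast at h h'
      rw [h, h']
      norm_num

/-- `Γ` is a `G`-invariant homogeneous polynomial of degree 12 which vanishes to order at
least 2 (it and all its first-order partial derivatives vanish) at each of the 12 points
of the `G`-orbit of `(9 : 2u : 4u)`, and which vanishes at each of the 72 points lying on
exactly two lines of `B₂₁`. -/
theorem stmt13 :
    Γpoly.IsHomogeneous 12 ∧
    (∀ M ∈ Ggrp, substMat (M : Matrix (Fin 3) (Fin 3) ℝ) Γpoly = Γpoly) ∧
    (orbitOf ![9, 2*u, 4*u]).ncard = 12 ∧
    (∀ Q ∈ orbitOf ![9, 2*u, 4*u],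
      MvPolynomial.eval (Projectivization.rep Q) Γpoly = 0 ∧
      ∀ i : Fin 3,
        MvPolynomial.eval (Projectivization.rep Q) (MvPolynomial.pderiv i Γpoly) = 0) ∧
    (∀ Q : P2R, multB21 Q = 2 →
      MvPolynomial.eval (Projectivization.rep Q) Γpoly = 0) :=
  ⟨part1, part2, part3, part4, part5⟩
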